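/- The Artin map Ψ is ergodic, and indeed mixing, with respect to the Ψ-invariant probability measure q·μ|_{X⁻¹O ∩ ᶜK}. -/

import Mathlib

open MeasureTheory
open scoped ENNReal Classical

noncomputable section

namespace ArtinCoding

variable (k : Type*) [Field k] [Fintype k]

/-- The field `K̂ = k((X⁻¹))` of formal Laurent series in `X⁻¹` over `k`, realized as the
field of formal Laurent series `k((t))` in the variable `t = X⁻¹`. -/
abbrev Khat := LaurentSeries k

variable {k}

/-- The absolute value `|f|_∞ = q^{-v_∞(f)}`, where `v_∞` is the order of vanishing in the
variable `t = X⁻¹` (so a nonzero polynomial in `X` has absolute value `≥ 1`). -/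
def absInf (f : Khat k) : ℝ :=
  if f = 0 then 0 else (Fintype.card k : ℝ) ^ (-f.order)

lemma absInf_nonneg (f : Khat k) : 0 ≤ absInf f := by
  unfold absInf
  split
  · exact le_refl 0
  · positivity

lemma absInf_eq_zero {f : Khat k} : absInf f = 0 ↔ f = 0 := by
  constructor
  · intro h
    by_contra hf
    have hq : (0:ℝ) < (Fintype.card k : ℝ) := by
      have := Fintype.card_pos (α := k); positivity
    rw [absInf, if_neg hf] at h
    exact absurd h (ne_of_gt (zpow_pos hq _))
  · intro h; simp [absInf, h]

lemma absInf_neg (f : Khat k) : absInf (-f) = absInf f := by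
  unfold absInf
  rw [neg_eq_zero, HahnSeries.order_neg]

lemma absInf_add_le (f g : Khat k) : absInf (f + g) ≤ max (absInf f) (absInf g) := by
  rcases eq_or_ne (f + g) 0 with h | h
  · rw [show absInf (f+g) = 0 by rw [absInf_eq_zero]; exact h]
    exact le_max_of_le_left (absInf_nonneg f)
  rcases eq_or_ne f 0 with hf | hf
  · simp [hf]
  rcases eq_or_ne g 0 with hg | hg
  · simp [hg]
  have hmin := HahnSeries.min_order_le_order_add h
  have hq : (1:ℝ) ≤ (Fintype.card k : ℝ) := by
    exact_mod_cast Nat.one_le_iff_ne_zero.mpr Fintype.card_ne_zero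
  rw [absInf, if_neg h]
  rcases le_total f.order g.order with hod | hod
  · rw [min_eq_left hod] at hmin
    refine le_max_of_le_left ?_
    rw [absInf, if_neg hf]
    exact zpow_le_zpow_right₀ hq (neg_le_neg hmin)
  · rw [min_eq_right hod] at hmin
    refine le_max_of_le_right ?_
    rw [absInf, if_neg hg]
    exact zpow_le_zpow_right₀ hq (neg_le_neg hmin)

/-- The metric `d_∞(f,g) = |f-g|_∞` on `K̂`. -/
noncomputable instance : MetricSpace (Khat k) where
  dist f g := absInf (f - g)
  dist_self f := by simp [absInf]
  dist_comm f g := by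
    have : g - f = -(f - g) := by ring
    show absInf (f - g) = absInf (g - f)
    rw [this, absInf_neg]
  dist_triangle f g h := by
    show absInf (f - h) ≤ absInf (f - g) + absInf (g - h)
    have key : absInf (f - h) ≤ max (absInf (f - g)) (absInf (g - h)) := by
      have : f - h = (f - g) + (g - h) := by ring
      rw [this]; exact absInf_add_le _ _
    exact key.trans (max_le_add_of_nonneg (absInf_nonneg _) (absInf_nonneg _))
  eq_of_dist_eq_zero := by
    intro f g h
    have : f - g = 0 := absInf_eq_zero.mp h
    exact sub_eq_zero.mp this

/- Make sure the topology coming from the metric `d_∞` is the one used everywhere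
(the valued-field uniformity on Laurent series induces the same topology). -/
instance (priority := 10000) : UniformSpace (Khat k) := PseudoMetricSpace.toUniformSpace
instance (priority := 10000) : TopologicalSpace (Khat k) := UniformSpace.toTopologicalSpace

instance : MeasurableSpace (Khat k) := borel _
instance : BorelSpace (Khat k) := ⟨rfl⟩

variable (k)

/-- The element `X⁻¹` of `K̂` (the uniformizer `t`). -/
def Xinv : Khat k := HahnSeries.single (1 : ℤ) (1 : k)

/-- The element `X` of `K̂`. -/
def Xel : Khat k := HahnSeries.single (-1 : ℤ) (1 : k)

/-- The valuation ring `O = k[[X⁻¹]] = {f : |f|_∞ ≤ 1}`. -/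
def Oball : Set (Khat k) := {f | absInf f ≤ 1}

/-- The set `X⁻¹O`, i.e. the maximal ideal of `O`. -/
def XinvO : Set (Khat k) := (fun f => Xinv k * f) '' Oball k

/-- The ring `A = k[X]` of polynomials in `X`, viewed as a subset of `K̂`. -/
def Aset : Set (Khat k) := Set.range fun p : Polynomial k => Polynomial.aeval (Xel k) p

/-- The constants `k ⊆ K̂`. -/
def kconsts : Set (Khat k) := Set.range (algebraMap k (Khat k))

/-- The set `A∖k` of nonconstant polynomials in `X`, viewed inside `K̂`. -/
def AmK : Set (Khat k) := Aset k \ kconsts k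

/-- The field `K = k(X)` of rational functions, viewed as a subset of `K̂`
(note that `k(X) = k(X⁻¹)` as a subfield of `K̂`). -/
def Kset : Set (Khat k) := Set.range fun r : RatFunc k => (r : LaurentSeries k)

/-- The set `ᶜK = K̂ ∖ K` of irrational elements. -/
def cK : Set (Khat k) := (Kset k)ᶜ

variable {k}

/-- The integer part `[f] ∈ A = k[X]` of `f ∈ K̂`: the sum of the terms of `f` with
nonpositive exponents in `t = X⁻¹`. -/
def intPart (f : Khat k) : Khat k :=
  ∑ i ∈ Finset.Icc (min f.order 0) 0, HahnSeries.single i (f.coeff i)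

/-- The fractional part `{f} = f - [f] ∈ X⁻¹O` of `f ∈ K̂`. -/
def fracPart (f : Khat k) : Khat k := f - intPart f

/-- The Artin map `Ψ(f) = 1/f - [1/f]`. -/
def ArtinPsi (f : Khat k) : Khat k := fracPart f⁻¹

/-- The Artin continued fraction digit `a_{n+1}(f) = [1/Ψⁿ(f)]` (for `n : ℕ`, so that
`digit 0 f = a₁(f) = [1/f]`). -/
def digit (n : ℕ) (f : Khat k) : Khat k := intPart ((ArtinPsi (k := k))^[n] f)⁻¹

variable (k)

/-- The set `J = ⋃_{a ∈ A∖k} (a + X⁻¹O)`. -/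
def Jset : Set (Khat k) := ⋃ a ∈ AmK k, (fun x => a + x) '' XinvO k

/-- The domain `Ω = (J ∩ ᶜK) × (X⁻¹O ∩ ᶜK)` of the natural extension of the Artin map. -/
def OmegaSet : Set (Khat k × Khat k) := (Jset k ∩ cK k) ×ˢ (XinvO k ∩ cK k)

variable {k}

/-- The map `Φ(ξ₋, ξ₊) = (1/ξ₋ - [1/ξ₊], Ψ(ξ₊))` (as a globally defined map on `K̂ × K̂`). -/
def PhiRaw (p : Khat k × Khat k) : Khat k × Khat k :=
  (p.1⁻¹ - intPart p.2⁻¹, ArtinPsi p.2)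

/-- The coding map `Θ'` sending `(ξ₋, ξ₊)` to the bilateral sequence `(c_n)_{n ∈ ℤ}` with
`c_n = a_n(ξ₊)` for `n ≥ 1` and `c_{-n} = a_{n+1}(-1/ξ₋)` for `n ≥ 0`. -/
def ThetaRaw (p : Khat k × Khat k) : ℤ → Khat k := fun n =>
  if 1 ≤ n then digit (n - 1).toNat p.2 else digit (-n).toNat (-p.1⁻¹)

variable (k)

/-- The density `q²/|ξ₊ - ξ₋|²_∞`. -/
def dens (p : Khat k × Khat k) : ℝ≥0∞ :=
  ENNReal.ofReal ((Fintype.card k : ℝ) ^ 2 * ((absInf (p.2 - p.1)) ^ 2)⁻¹)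

/-- The measure `m̂` on `Ω` given by `dm̂(ξ₋,ξ₊) = q² dμ(ξ₋) dμ(ξ₊)/|ξ₊ - ξ₋|²_∞`. -/
def mhat (μ : Measure (Khat k)) : Measure (Khat k × Khat k) :=
  (((μ.prod μ).withDensity (dens k))).restrict (OmegaSet k)

/-- The weight `ν(a) = |a|_∞⁻² = q^{-2 deg a}` for `a ∈ A∖k` (and `0` otherwise),
with values in `ℝ≥0∞`. -/
def nuE (a : Khat k) : ℝ≥0∞ :=
  if a ∈ AmK k then ENNReal.ofReal (((absInf a) ^ 2)⁻¹) else 0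

section Mixing

open Set Metric

variable {k}

lemma one_lt_card_real : (1 : ℝ) < Fintype.card k := by
  exact_mod_cast Fintype.one_lt_card

lemma absInf_zero : absInf (0 : Khat k) = 0 := absInf_eq_zero.2 rfl

lemma absInf_pos {f : Khat k} (hf : f ≠ 0) : 0 < absInf f :=
  lt_of_le_of_ne (absInf_nonneg f) fun h => hf (absInf_eq_zero.1 h.symm)

lemma absInf_of_ne {f : Khat k} (hf : f ≠ 0) :
    absInf f = (Fintype.card k : ℝ) ^ (-f.order) := if_neg hf

lemma absInf_one : absInf (1 : Khat k) = 1 := by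
  rw [absInf_of_ne one_ne_zero, HahnSeries.order_one]; simp

lemma absInf_mul (f g : Khat k) : absInf (f * g) = absInf f * absInf g := by
  rcases eq_or_ne f 0 with rfl | hf
  · simp [absInf_zero]
  rcases eq_or_ne g 0 with rfl | hg
  · simp [absInf_zero]
  have hq : (Fintype.card k : ℝ) ≠ 0 := by
    have := one_lt_card_real (k := k); positivity
  rw [absInf_of_ne hf, absInf_of_ne hg, absInf_of_ne (mul_ne_zero hf hg),
    HahnSeries.order_mul hf hg, ← zpow_add₀ hq, neg_add]

lemma absInf_inv (f : Khat k) : absInf f⁻¹ = (absInf f)⁻¹ := by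
  rcases eq_or_ne f 0 with rfl | hf
  · simp [absInf_zero]
  · apply eq_inv_of_mul_eq_one_left
    rw [← absInf_mul, inv_mul_cancel₀ hf, absInf_one]

lemma dist_eq_absInf (f g : Khat k) : dist f g = absInf (f - g) := rfl

instance : IsUltrametricDist (Khat k) where
  dist_triangle_max f g h := by
    simp only [dist_eq_absInf]
    have := absInf_add_le (f - g) (g - h)
    rwa [sub_add_sub_cancel] at this

lemma absInf_lt_zpow_iff {f : Khat k} {m : ℤ} :
    absInf f < (Fintype.card k : ℝ) ^ (-m) ↔ ∀ i ≤ m, f.coeff i = 0 := by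
  have hq := one_lt_card_real (k := k)
  rcases eq_or_ne f 0 with rfl | hf
  · simp only [absInf_zero, HahnSeries.coeff_zero, implies_true, iff_true]
    positivity
  rw [absInf_of_ne hf, zpow_lt_zpow_iff_right₀ hq, neg_lt_neg_iff]
  constructor
  · intro h i hi
    exact HahnSeries.coeff_eq_zero_of_lt_order (hi.trans_lt h)
  · intro h
    by_contra hc
    exact HahnSeries.coeff_order_eq_zero.not.2 hf (h _ (not_lt.1 hc))

lemma absInf_lt_one_iff {f : Khat k} : absInf f < 1 ↔ ∀ i ≤ 0, f.coeff i = 0 := by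
  simpa using absInf_lt_zpow_iff (f := f) (m := 0)

/-- The absolute values of nonzero elements of `X⁻¹O` are negative powers of `q`. -/
lemma exists_absInf_eq_pow {f : Khat k} (hf : f ≠ 0) (h1 : absInf f < 1) :
    ∃ j : ℕ, 1 ≤ j ∧ absInf f = ((Fintype.card k : ℝ)⁻¹) ^ j := by
  have hq := one_lt_card_real (k := k)
  rw [absInf_of_ne hf] at h1 ⊢
  have h : -f.order < 0 := by
    rwa [← zpow_lt_zpow_iff_right₀ hq, zpow_zero]
  lift f.order to ℕ using (by omega) with j
  exact ⟨j, by omega, by rw [zpow_neg, zpow_natCast, inv_pow]⟩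

lemma XinvO_eq_ball : XinvO k = ball (0 : Khat k) 1 := by
  have hq := one_lt_card_real (k := k)
  have hX : absInf (Xinv k) = (Fintype.card k : ℝ)⁻¹ := by
    have hx : Xinv k ≠ 0 := by simp [Xinv]
    rw [absInf_of_ne hx, Xinv, HahnSeries.order_single one_ne_zero, zpow_neg_one]
  ext f
  simp only [XinvO, Oball, mem_image, mem_ofPred_eq, mem_ball, dist_eq_absInf, sub_zero]
  constructor
  · rintro ⟨g, hg, rfl⟩
    rw [absInf_mul, hX]
    calc _ ≤ (Fintype.card k : ℝ)⁻¹ * 1 := by gcongr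
      _ < 1 := by rw [mul_one]; exact inv_lt_one_of_one_lt₀ hq
  · intro hf
    have hx : Xinv k ≠ 0 := by simp [Xinv]
    refine ⟨(Xinv k)⁻¹ * f, ?_, mul_inv_cancel_left₀ hx f⟩
    rcases eq_or_ne f 0 with rfl | hf0
    · simp [absInf_zero]
    obtain ⟨j, hj, hfj⟩ := exists_absInf_eq_pow hf0 hf
    rw [absInf_mul, absInf_inv, hX, inv_inv, hfj]
    obtain ⟨i, rfl⟩ := Nat.exists_eq_add_of_le' hj
    rw [pow_succ, mul_comm, mul_assoc, inv_mul_cancel₀ (by positivity), mul_one]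
    exact pow_le_one₀ (by positivity) (inv_le_one_of_one_le₀ hq.le)

lemma coeff_intPart {k : Type*} [Field k] (f : Khat k) (i : ℤ) :
    (intPart f).coeff i = if i ≤ 0 then f.coeff i else 0 := by
  have : (intPart f).coeff i =
      ∑ j ∈ Finset.Icc (min f.order 0) 0, (HahnSeries.single j (f.coeff j)).coeff i := by
    unfold intPart
    exact map_sum (HahnSeries.coeff.addMonoidHom (Γ := ℤ) (R := k) i) _ _
  rw [this]
  by_cases hm : i ∈ Finset.Icc (min f.order 0) 0
  · rw [Finset.sum_eq_single_of_mem i hm fun b _ hb => HahnSeries.coeff_single_of_ne hb.symm,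
      HahnSeries.coeff_single_same, if_pos (Finset.mem_Icc.1 hm).2]
  · rw [Finset.sum_eq_zero fun b hb =>
      HahnSeries.coeff_single_of_ne (ne_of_mem_of_not_mem hb hm).symm]
    split_ifs with hi
    · refine (HahnSeries.coeff_eq_zero_of_lt_order ?_).symm
      rw [Finset.mem_Icc] at hm
      omega
    · rfl

lemma coeff_fracPart {k : Type*} [Field k] (f : Khat k) (i : ℤ) :
    (fracPart f).coeff i = if i ≤ 0 then 0 else f.coeff i := by
  rw [fracPart, HahnSeries.coeff_sub, coeff_intPart]
  split_ifs <;> simp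

lemma fracPart_sub {k : Type*} [Field k] (f g : Khat k) : fracPart (f - g) = fracPart f - fracPart g := by
  ext i
  simp only [coeff_fracPart, HahnSeries.coeff_sub]
  split_ifs <;> simp

lemma fracPart_of_absInf_lt_one {f : Khat k} (hf : absInf f < 1) : fracPart f = f := by
  ext i
  rw [coeff_fracPart]
  split_ifs with h
  · exact (absInf_lt_one_iff.1 hf i h).symm
  · rfl

lemma absInf_fracPart_lt_one (f : Khat k) : absInf (fracPart f) < 1 := by
  rw [absInf_lt_one_iff]
  intro i hi
  rw [coeff_fracPart, if_pos hi]

lemma absInf_eq_of_dist_lt {x y : Khat k} (h : dist y x < absInf x) : absInf y = absInf x := by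
  rw [dist_eq_absInf] at h
  apply le_antisymm
  · have := absInf_add_le (y - x) x
    rw [sub_add_cancel] at this
    exact this.trans (max_le h.le le_rfl)
  · have h1 := absInf_add_le (-(y - x)) y
    rw [absInf_neg, show -(y - x) + y = x by ring] at h1
    rcases le_max_iff.1 h1 with h2 | h2
    · exact absurd h2 (not_le.2 h)
    · exact h2

lemma dist_inv_inv {x y : Khat k} (hx : x ≠ 0) (hy : y ≠ 0) :
    dist y⁻¹ x⁻¹ = dist y x / (absInf x * absInf y) := by
  rw [dist_eq_absInf, dist_eq_absInf, inv_sub_inv hy hx, div_eq_mul_inv, absInf_mul, absInf_inv,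
    absInf_mul, ← absInf_neg, neg_sub, div_eq_mul_inv, mul_comm (absInf x)]

/-- The Artin map is locally a similarity with ratio `|x|⁻²`. -/
lemma dist_ArtinPsi {x y : Khat k} (h1 : dist y x < absInf x) (h2 : dist y x < absInf x ^ 2) :
    dist (ArtinPsi y) (ArtinPsi x) = dist y x / absInf x ^ 2 := by
  have hpos : 0 < absInf x := dist_nonneg.trans_lt h1
  have hxy := absInf_eq_of_dist_lt h1
  have hx : x ≠ 0 := by rintro rfl; simp [absInf_zero] at hpos
  have hy : y ≠ 0 := by rintro rfl; rw [← hxy] at hpos; simp [absInf_zero] at hpos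
  have h3 := dist_inv_inv hx hy
  rw [hxy, ← sq] at h3
  rw [← h3, dist_eq_absInf, dist_eq_absInf, ArtinPsi, ArtinPsi, ← fracPart_sub,
    fracPart_of_absInf_lt_one]
  rw [← dist_eq_absInf, h3]
  exact (div_lt_one (by positivity)).2 h2

lemma ArtinPsi_mem_ball (x : Khat k) : ArtinPsi x ∈ ball (0 : Khat k) 1 := by
  rw [mem_ball, dist_eq_absInf, sub_zero]
  exact absInf_fracPart_lt_one _

lemma measurable_ArtinPsi : Measurable (ArtinPsi (k := k)) := by
  refine measurable_of_continuousOn_compl_singleton 0 fun x hx => ContinuousAt.continuousWithinAt ?_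
  have hpos : 0 < absInf x := absInf_pos hx
  rw [Metric.continuousAt_iff]
  intro ε hε
  refine ⟨min (min (absInf x) (absInf x ^ 2)) (ε * absInf x ^ 2), by positivity, fun {y} hy => ?_⟩
  rw [lt_min_iff, lt_min_iff] at hy
  rw [dist_ArtinPsi hy.1.1 hy.1.2]
  exact (div_lt_iff₀ (by positivity)).2 hy.2

lemma dist_ArtinPsi_of_mem {x y : Khat k} (hx : absInf x < 1) (h : y ∈ ball x (absInf x ^ 2)) :
    dist (ArtinPsi y) (ArtinPsi x) = dist y x / absInf x ^ 2 := by
  refine dist_ArtinPsi ((mem_ball.1 h).trans_le ?_) (mem_ball.1 h)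
  have := absInf_nonneg x
  nlinarith

lemma absInf_eq_of_mem {x y : Khat k} (hx : absInf x < 1) (h : y ∈ ball x (absInf x ^ 2)) :
    absInf y = absInf x := by
  refine absInf_eq_of_dist_lt ((mem_ball.1 h).trans_le ?_)
  have := absInf_nonneg x
  nlinarith

lemma exists_ArtinPsi_eq {x z : Khat k} (hx0 : x ≠ 0) (hx : absInf x < 1) (hz : absInf z < 1) :
    ∃ y ∈ ball x (absInf x ^ 2), ArtinPsi y = z := by
  have hpos : 0 < absInf x := absInf_pos hx0
  set w := intPart x⁻¹ + z with hw
  have hwx : w - x⁻¹ = z - fracPart x⁻¹ := by rw [hw, fracPart]; ring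
  have hlt : dist w x⁻¹ < 1 := by
    rw [dist_eq_absInf, hwx, sub_eq_add_neg]
    refine (absInf_add_le _ _).trans_lt (max_lt hz ?_)
    rw [absInf_neg]
    exact absInf_fracPart_lt_one _
  have hinv : 1 < absInf x⁻¹ := by rw [absInf_inv]; exact (one_lt_inv₀ hpos).2 hx
  have habs : absInf w = absInf x⁻¹ := absInf_eq_of_dist_lt (hlt.trans hinv)
  have hw0 : w ≠ 0 := by
    intro h; rw [h, absInf_zero] at habs; linarith
  refine ⟨w⁻¹, ?_, ?_⟩
  · have h := dist_inv_inv (inv_ne_zero hx0) hw0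
    rw [inv_inv, habs, absInf_inv, ← mul_inv, ← sq, div_inv_eq_mul] at h
    rw [mem_ball, h]
    calc _ < 1 * absInf x ^ 2 := by gcongr
      _ = _ := one_mul _
  · have h : fracPart w - fracPart x⁻¹ = w - x⁻¹ := by
      rw [← fracPart_sub, fracPart_of_absInf_lt_one hlt]
    rw [hwx] at h
    rw [ArtinPsi, inv_inv]
    exact sub_left_injective h

lemma ArtinPsi_preimage_ball {x y : Khat k} (hx0 : x ≠ 0) (hx : absInf x < 1)
    (hy : y ∈ ball x (absInf x ^ 2)) {r : ℝ} (hr : r ≤ 1) :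
    ball x (absInf x ^ 2) ∩ ArtinPsi ⁻¹' ball (ArtinPsi y) r = ball y (r * absInf x ^ 2) := by
  have hpos : 0 < absInf x := absInf_pos hx0
  have hyx := absInf_eq_of_mem hx hy
  rw [IsUltrametricDist.ball_eq_of_mem hy, ← hyx]
  ext w
  constructor
  · rintro ⟨h1, h2⟩
    rw [mem_preimage, mem_ball, dist_ArtinPsi_of_mem (hyx ▸ hx) h1,
      div_lt_iff₀ (by rw [hyx]; positivity)] at h2
    exact h2
  · intro h
    have h1 : w ∈ ball y (absInf y ^ 2) :=
      ball_subset_ball (mul_le_of_le_one_left (sq_nonneg _) hr) h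
    refine ⟨h1, ?_⟩
    rw [mem_preimage, mem_ball, dist_ArtinPsi_of_mem (hyx ▸ hx) h1,
      div_lt_iff₀ (by rw [hyx]; positivity)]
    exact h

lemma hasSum_measureReal_iUnion {α : Type*} [MeasurableSpace α] (ν : Measure α)
    [IsFiniteMeasure ν] {f : ℕ → Set α} (hd : Pairwise (Function.onFun Disjoint f))
    (hf : ∀ i, MeasurableSet (f i)) :
    HasSum (fun i => ν.real (f i)) (ν.real (⋃ i, f i)) := by
  have h := measure_iUnion (μ := ν) hd hf
  have hne : ∑' i, ν (f i) ≠ ⊤ := h ▸ measure_ne_top ν _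
  rw [measureReal_def, h, ENNReal.tsum_toReal_eq (ENNReal.ne_top_of_tsum_ne_top hne)]
  exact ENNReal.hasSum_toReal hne

lemma exists_pow_lt {ε : ℝ} (hε : 0 < ε) : ∃ m : ℕ, ((Fintype.card k : ℝ)⁻¹) ^ m < ε :=
  exists_pow_lt_of_lt_one hε (inv_lt_one_of_one_lt₀ one_lt_card_real)

instance : TopologicalSpace.SeparableSpace (Khat k) := by
  have : Countable (ℤ →₀ k) := inferInstance
  refine ⟨⟨range (HahnSeries.ofFinsupp : (ℤ →₀ k) → Khat k), countable_range _, ?_⟩⟩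
  rw [Metric.dense_iff]
  intro f r hr
  obtain ⟨m, hm⟩ := exists_pow_lt (k := k) hr
  refine ⟨HahnSeries.ofFinsupp (Finsupp.onFinset (Finset.Icc f.order m)
    (fun i => if i ∈ Finset.Icc f.order m then f.coeff i else 0) ?_), ?_, mem_range_self _⟩
  · intro i hi
    by_contra h
    exact hi (if_neg h)
  · rw [mem_ball, dist_comm, dist_eq_absInf]
    refine lt_trans ?_ hm
    rw [inv_pow, ← zpow_natCast, ← zpow_neg, absInf_lt_zpow_iff]
    intro i hi
    rw [HahnSeries.coeff_sub]
    change f.coeff i - (if i ∈ Finset.Icc f.order m then f.coeff i else 0) = 0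
    by_cases h : f.order ≤ i
    · rw [if_pos (Finset.mem_Icc.2 ⟨h, hi⟩)]
      exact sub_self _
    · rw [if_neg fun hc => h (Finset.mem_Icc.1 hc).1, sub_zero]
      exact HahnSeries.coeff_eq_zero_of_lt_order (not_le.1 h)

instance : SecondCountableTopology (Khat k) :=
  UniformSpace.secondCountable_of_separable _

variable (k) in
/-- The balls whose radius is a nonpositive power of `q`. -/
def smallBalls : Set (Set (Khat k)) :=
  range fun p : Khat k × ℕ => ball p.1 ((Fintype.card k : ℝ)⁻¹ ^ p.2)

lemma inv_card_pow_le_one (m : ℕ) : (Fintype.card k : ℝ)⁻¹ ^ m ≤ 1 :=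
  pow_le_one₀ (by positivity) (inv_le_one_of_one_le₀ one_lt_card_real.le)

lemma isPiSystem_smallBalls : IsPiSystem (smallBalls k) := by
  rintro _ ⟨⟨x, m⟩, rfl⟩ _ ⟨⟨y, n⟩, rfl⟩ hne
  rcases IsUltrametricDist.ball_subset_trichotomy x y ((Fintype.card k : ℝ)⁻¹ ^ m)
    ((Fintype.card k : ℝ)⁻¹ ^ n) with h | h | h
  · exact ⟨⟨x, m⟩, (inter_eq_left.2 h).symm⟩
  · exact ⟨⟨y, n⟩, (inter_eq_right.2 h).symm⟩
  · exact absurd hne (not_nonempty_iff_eq_empty.2 h.inter_eq)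

lemma borel_eq_generateFrom_smallBalls :
    (inferInstance : MeasurableSpace (Khat k)) = MeasurableSpace.generateFrom (smallBalls k) := by
  refine TopologicalSpace.IsTopologicalBasis.borel_eq_generateFrom
    (TopologicalSpace.isTopologicalBasis_of_isOpen_of_nhds ?_ ?_)
  · rintro _ ⟨p, rfl⟩
    exact isOpen_ball
  · intro a u ha hu
    obtain ⟨ε, hε, h⟩ := Metric.isOpen_iff.1 hu a ha
    obtain ⟨m, hm⟩ := exists_pow_lt (k := k) hε
    refine ⟨_, ⟨⟨a, m⟩, rfl⟩, mem_ball_self ?_, (ball_subset_ball hm.le).trans h⟩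
    have := one_lt_card_real (k := k)
    positivity

lemma measure_ball_eq {μ : Measure (Khat k)} (hinv : ∀ x : Khat k, μ.map (fun y => x + y) = μ)
    (x : Khat k) (r : ℝ) : μ (ball x r) = μ (ball 0 r) := by
  have hm : Measurable fun y : Khat k => x + y := by
    have : Isometry fun y : Khat k => x + y := by
      refine Isometry.of_dist_eq fun a b => ?_
      rw [dist_eq_absInf, dist_eq_absInf, add_sub_add_left_eq_sub]
    exact this.continuous.measurable
  conv_lhs => rw [← hinv x, Measure.map_apply hm measurableSet_ball]
  congr 1
  ext y
  rw [mem_preimage, mem_ball, mem_ball, dist_eq_absInf, dist_eq_absInf, add_sub_cancel_left,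
    sub_zero]

lemma measure_ball_zpow {μ : Measure (Khat k)} (hinv : ∀ x : Khat k, μ.map (fun y => x + y) = μ)
    (m : ℤ) : μ (ball 0 ((Fintype.card k : ℝ) ^ (-m))) =
      Fintype.card k * μ (ball 0 ((Fintype.card k : ℝ) ^ (-(m + 1)))) := by
  have hcoeff (c : k) (f : Khat k) (i : ℤ) :
      (f - HahnSeries.single (m + 1) c).coeff i = f.coeff i - if i = m + 1 then c else 0 := by
    rw [HahnSeries.coeff_sub, HahnSeries.coeff_single]
    congr
  have hU : ball (0 : Khat k) ((Fintype.card k : ℝ) ^ (-m)) = ⋃ c ∈ (Finset.univ : Finset k),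
      ball (HahnSeries.single (m + 1) c) ((Fintype.card k : ℝ) ^ (-(m + 1))) := by
    ext f
    simp only [mem_iUnion, mem_ball, dist_eq_absInf, sub_zero, absInf_lt_zpow_iff, hcoeff,
      Finset.mem_univ, exists_true_left]
    constructor
    · intro h
      refine ⟨f.coeff (m + 1), fun i hi => ?_⟩
      rcases eq_or_ne i (m + 1) with rfl | hne
      · simp
      · rw [if_neg hne, sub_zero]
        exact h i (by omega)
    · rintro ⟨c, h⟩ i hi
      have := h i (by omega)
      rwa [if_neg (by omega), sub_zero] at this
  rw [hU, measure_biUnion_finset]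
  · simp_rw [measure_ball_eq hinv (HahnSeries.single (m + 1) _)]
    rw [Finset.sum_const, Finset.card_univ, nsmul_eq_mul]
  · intro c _ d _ hcd
    rw [Function.onFun, Set.disjoint_left]
    intro f hc hd
    rw [mem_ball, dist_eq_absInf, absInf_lt_zpow_iff] at hc hd
    have h1 := hc (m + 1) le_rfl
    have h2 := hd (m + 1) le_rfl
    rw [hcoeff, if_pos rfl, sub_eq_zero] at h1 h2
    exact hcd (h1.symm.trans h2)
  · exact fun _ _ => measurableSet_ball

lemma card_ne_zero_ennreal : (Fintype.card k : ℝ≥0∞) ≠ 0 := by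
  exact_mod_cast Fintype.card_ne_zero

lemma Oball_eq_ball : Oball k = ball (0 : Khat k) ((Fintype.card k : ℝ) ^ (-(-1 : ℤ))) := by
  have hq := one_lt_card_real (k := k)
  ext f
  rw [mem_ball, dist_eq_absInf, sub_zero, Oball, mem_ofPred_eq]
  rcases eq_or_ne f 0 with rfl | hf
  · simp only [absInf_zero, zero_le_one, true_iff]
    positivity
  rw [absInf_of_ne hf, zpow_lt_zpow_iff_right₀ hq, ← zpow_zero (Fintype.card k : ℝ),
    zpow_le_zpow_iff_right₀ hq]
  omega

/-- A ball of radius `q⁻ᵐ` has measure `q⁻ᵐ⁻¹`. -/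
lemma measure_ball_pow {μ : Measure (Khat k)} (hinv : ∀ x : Khat k, μ.map (fun y => x + y) = μ)
    (hO : μ (Oball k) = 1) (x : Khat k) (m : ℕ) :
    μ (ball x ((Fintype.card k : ℝ)⁻¹ ^ m)) = (Fintype.card k : ℝ≥0∞)⁻¹ ^ (m + 1) := by
  have hstep {a b : ℝ≥0∞} (h : a = Fintype.card k * b) : b = (Fintype.card k : ℝ≥0∞)⁻¹ * a := by
    rw [h, ← mul_assoc, ENNReal.inv_mul_cancel card_ne_zero_ennreal (ENNReal.natCast_ne_top _),
      one_mul]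
  rw [measure_ball_eq hinv, inv_pow, ← zpow_natCast, ← zpow_neg]
  induction m with
  | zero =>
    have h := hstep (measure_ball_zpow hinv (-1))
    rw [← Oball_eq_ball, hO] at h
    simpa using h
  | succ m ih =>
    have h := hstep (measure_ball_zpow hinv m)
    rw [ih] at h
    rw [pow_succ', ← h]
    push_cast
    rfl

/-- The measure `μ` restricted to `X⁻¹O` and normalized. -/
def normMeasure (μ : Measure (Khat k)) : Measure (Khat k) :=
  (Fintype.card k : ℝ≥0∞) • μ.restrict (ball 0 1)

lemma normMeasure_apply {μ : Measure (Khat k)} {s : Set (Khat k)} (hs : MeasurableSet s) :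
    normMeasure μ s = Fintype.card k * μ (s ∩ ball 0 1) := by
  rw [normMeasure, Measure.smul_apply, Measure.restrict_apply hs, smul_eq_mul]

lemma ball_pow_subset_or_disjoint (x : Khat k) (m : ℕ) :
    ball x ((Fintype.card k : ℝ)⁻¹ ^ m) ⊆ ball 0 1 ∨
      Disjoint (ball x ((Fintype.card k : ℝ)⁻¹ ^ m)) (ball 0 1) := by
  have h := ball_subset_ball (x := x) (inv_card_pow_le_one (k := k) m)
  rcases IsUltrametricDist.ball_eq_or_disjoint x 0 1 with h1 | h1
  · exact Or.inl (h1 ▸ h)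
  · exact Or.inr (h1.mono_left h)

section

variable {μ : Measure (Khat k)} (hinv : ∀ x : Khat k, μ.map (fun y => x + y) = μ)
  (hO : μ (Oball k) = 1)

include hinv hO

lemma isProbabilityMeasure_normMeasure : IsProbabilityMeasure (normMeasure μ) := by
  constructor
  have h := measure_ball_pow hinv hO 0 0
  rw [pow_zero, zero_add, pow_one] at h
  rw [normMeasure_apply MeasurableSet.univ, univ_inter, h]
  exact ENNReal.mul_inv_cancel card_ne_zero_ennreal (ENNReal.natCast_ne_top _)

lemma normMeasure_ball {x : Khat k} {m : ℕ}
    (hsub : ball x ((Fintype.card k : ℝ)⁻¹ ^ m) ⊆ ball 0 1) :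
    normMeasure μ (ball x ((Fintype.card k : ℝ)⁻¹ ^ m)) = (Fintype.card k : ℝ≥0∞)⁻¹ ^ m := by
  rw [normMeasure_apply measurableSet_ball, inter_eq_left.2 hsub, measure_ball_pow hinv hO,
    pow_succ', ← mul_assoc,
    ENNReal.mul_inv_cancel card_ne_zero_ennreal (ENNReal.natCast_ne_top _), one_mul]

lemma measure_singleton_eq_zero (x : Khat k) : μ {x} = 0 := by
  have hlt : (Fintype.card k : ℝ≥0∞)⁻¹ < 1 := by
    rw [ENNReal.inv_lt_one]
    exact_mod_cast Fintype.one_lt_card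
  have ht := (ENNReal.tendsto_pow_atTop_nhds_zero_of_lt_one hlt).comp
    (Filter.tendsto_add_atTop_nat 1)
  refine le_antisymm (ge_of_tendsto' ht fun m => ?_) zero_le
  rw [Function.comp_apply, ← measure_ball_pow hinv hO x m]
  refine measure_mono (singleton_subset_iff.2 (mem_ball_self ?_))
  have := one_lt_card_real (k := k)
  positivity

lemma normMeasure_eq :
    (Fintype.card k : ℝ≥0∞) • μ.restrict (XinvO k ∩ cK k) = normMeasure μ := by
  have hpoly : Countable (Polynomial k) := by
    rw [← Cardinal.mk_le_aleph0_iff]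
    exact Polynomial.cardinalMk_le_max.trans (max_le (Cardinal.mk_le_aleph0) le_rfl)
  have hrat : Countable (RatFunc k) := by
    refine Function.Surjective.countable (f := fun p : Polynomial k × Polynomial k =>
      (algebraMap _ (RatFunc k) p.1 / algebraMap _ (RatFunc k) p.2)) fun x => ?_
    induction x using RatFunc.induction_on with
    | _ p q _ => exact ⟨(p, q), rfl⟩
  have hK : μ (Kset k) = 0 := by
    rw [Kset, ← biUnion_of_singleton (range _), measure_biUnion_null_iff (countable_range _)]
    exact fun x _ => measure_singleton_eq_zero hinv hO x
  rw [normMeasure, XinvO_eq_ball]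
  congr 1
  refine Measure.restrict_congr_set ?_
  have : cK k =ᵐ[μ] univ := Filter.eventuallyEq_univ.2 (compl_mem_ae_iff.2 hK)
  simpa using Filter.EventuallyEq.rfl.inter this

lemma normMeasure_cylinder {x : Khat k} (hx0 : x ≠ 0) (hx : absInf x < 1) {E : Set (Khat k)}
    (hE : MeasurableSet E) :
    normMeasure μ (ball x (absInf x ^ 2) ∩ ArtinPsi ⁻¹' E) =
      normMeasure μ (ball x (absInf x ^ 2)) * normMeasure μ E := by
  have := isProbabilityMeasure_normMeasure hinv hO
  obtain ⟨j, hj, hxj⟩ := exists_absInf_eq_pow hx0 hx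
  have hpos := absInf_pos hx0
  have hle : absInf x ^ 2 ≤ 1 := pow_le_one₀ hpos.le hx.le
  have hball {y : Khat k} (hy : absInf y < 1) {r : ℝ} (hr : r ≤ 1) : ball y r ⊆ ball 0 1 := by
    have hy' : y ∈ ball (0 : Khat k) 1 := by rwa [mem_ball, dist_eq_absInf, sub_zero]
    rw [IsUltrametricDist.ball_eq_of_mem hy']
    exact ball_subset_ball hr
  have hpow : absInf x ^ 2 = (Fintype.card k : ℝ)⁻¹ ^ (j * 2) := by rw [hxj, pow_mul]
  have hmeas : normMeasure μ (ball x (absInf x ^ 2)) = (Fintype.card k : ℝ≥0∞)⁻¹ ^ (j * 2) := by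
    rw [hpow]
    exact normMeasure_ball hinv hO (hpow ▸ hball hx hle)
  have key : ((normMeasure μ).restrict (ball x (absInf x ^ 2))).map ArtinPsi =
      normMeasure μ (ball x (absInf x ^ 2)) • normMeasure μ := by
    have happ {s : Set (Khat k)} (hs : MeasurableSet s) :
        (((normMeasure μ).restrict (ball x (absInf x ^ 2))).map ArtinPsi) s =
          normMeasure μ (ball x (absInf x ^ 2) ∩ ArtinPsi ⁻¹' s) := by
      rw [Measure.map_apply measurable_ArtinPsi hs,
        Measure.restrict_apply (measurable_ArtinPsi hs), inter_comm]
    refine ext_of_generate_finite (smallBalls k) borel_eq_generateFrom_smallBalls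
      isPiSystem_smallBalls ?_ ?_
    · rintro _ ⟨⟨z, m⟩, rfl⟩
      rw [happ measurableSet_ball, Measure.smul_apply, smul_eq_mul]
      rcases ball_pow_subset_or_disjoint z m with h | h
      · have hz : absInf z < 1 := by
          have hq := one_lt_card_real (k := k)
          have := h (mem_ball_self (by positivity))
          rwa [mem_ball, dist_eq_absInf, sub_zero] at this
        obtain ⟨y, hy, rfl⟩ := exists_ArtinPsi_eq hx0 hx hz
        have hy1 : absInf y < 1 := by rwa [absInf_eq_of_mem hx hy]
        have hm := inv_card_pow_le_one (k := k) m
        have hle' := mul_le_one₀ hm (sq_nonneg _) hle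
        dsimp only
        rw [ArtinPsi_preimage_ball hx0 hx hy hm, hmeas, normMeasure_ball hinv hO h, ← pow_add,
          add_comm]
        rw [hpow, ← pow_add] at hle' ⊢
        exact normMeasure_ball hinv hO (hball hy1 hle')
      · have h1 : ArtinPsi ⁻¹' ball z ((Fintype.card k : ℝ)⁻¹ ^ m) = ∅ := by
          ext w
          simp only [mem_preimage, mem_empty_iff_false, iff_false]
          exact fun hw => Set.disjoint_left.1 h hw (ArtinPsi_mem_ball w)
        rw [h1, inter_empty, measure_empty]
        dsimp only
        rw [normMeasure_apply (s := ball z _) measurableSet_ball, h.inter_eq, measure_empty,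
          mul_zero, mul_zero]
    · rw [happ MeasurableSet.univ, preimage_univ, inter_univ, Measure.smul_apply, measure_univ,
        smul_eq_mul, mul_one]
  rw [← smul_eq_mul, ← Measure.smul_apply, ← key, Measure.map_apply measurable_ArtinPsi hE,
    Measure.restrict_apply (measurable_ArtinPsi hE), inter_comm]

/-- Preimages under the Artin map are independent of sets that are unions of cylinders. -/
lemma normMeasure_inter_preimage {U : Set (Khat k)} (hU : U ⊆ ball 0 1)
    (hcyl : ∀ x ∈ U, x ≠ 0 → ball x (absInf x ^ 2) ⊆ U) {E : Set (Khat k)}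
    (hE : MeasurableSet E) :
    normMeasure μ (U ∩ ArtinPsi ⁻¹' E) = normMeasure μ U * normMeasure μ E := by
  set S : Set (Set (Khat k)) := (fun x => ball x (absInf x ^ 2)) '' (U \ {0}) with hS
  have hlt {x : Khat k} (hx : x ∈ U) : absInf x < 1 := by
    have := hU hx
    rwa [mem_ball, dist_eq_absInf, sub_zero] at this
  have hself {x : Khat k} (hx : x ≠ 0) : x ∈ ball x (absInf x ^ 2) :=
    mem_ball_self (pow_pos (absInf_pos hx) 2)
  have hSU : ⋃₀ S = U \ {0} := by
    ext y
    simp only [hS, sUnion_image, mem_iUnion]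
    constructor
    · rintro ⟨x, ⟨hx, hx0⟩, hy⟩
      refine ⟨hcyl x hx hx0 hy, fun h => hx0 ?_⟩
      rw [mem_singleton_iff] at h
      rw [mem_singleton_iff, ← absInf_eq_zero, ← absInf_eq_of_mem (hlt hx) hy, h, absInf_zero]
    · exact fun hy => ⟨y, hy, hself hy.2⟩
  have hdisj : S.Pairwise Disjoint := by
    rintro _ ⟨x, hx, rfl⟩ _ ⟨y, hy, rfl⟩ hne
    by_contra hnd
    obtain ⟨z, hzx, hzy⟩ := Set.not_disjoint_iff.1 hnd
    apply hne
    dsimp only at hzx hzy ⊢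
    rw [IsUltrametricDist.ball_eq_of_mem hzx, IsUltrametricDist.ball_eq_of_mem hzy,
      ← absInf_eq_of_mem (hlt hx.1) hzx, ← absInf_eq_of_mem (hlt hy.1) hzy]
  have hcount : S.Countable := by
    refine Set.PairwiseDisjoint.countable_of_isOpen (s := id) hdisj ?_ ?_
    · rintro _ ⟨x, _, rfl⟩
      exact isOpen_ball
    · rintro _ ⟨x, hx, rfl⟩
      exact ⟨x, hself hx.2⟩
  have hSm : ∀ s ∈ S, MeasurableSet s := by
    rintro _ ⟨x, _, rfl⟩
    exact measurableSet_ball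
  have hUS : ⋃₀ S =ᵐ[normMeasure μ] U := by
    rw [hSU]
    refine sdiff_null_ae_eq_self ?_
    rw [normMeasure_apply (measurableSet_singleton _)]
    rw [measure_mono_null inter_subset_left (measure_singleton_eq_zero hinv hO 0), mul_zero]
  have hpre := measurable_ArtinPsi hE
  rw [← measure_congr hUS, ← measure_congr (hUS.inter (.refl _ (ArtinPsi ⁻¹' E))),
    ← Measure.restrict_apply' hpre, measure_sUnion hcount hdisj hSm,
    measure_sUnion hcount hdisj hSm, ← ENNReal.tsum_mul_right]
  refine tsum_congr ?_
  rintro ⟨_, x, hx, rfl⟩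
  rw [Measure.restrict_apply' hpre]
  exact normMeasure_cylinder hinv hO hx.2 (hlt hx.1) hE

lemma measurePreserving_ArtinPsi :
    MeasurePreserving (ArtinPsi (k := k)) (normMeasure μ) (normMeasure μ) := by
  have := isProbabilityMeasure_normMeasure hinv hO
  refine ⟨measurable_ArtinPsi, Measure.ext fun E hE => ?_⟩
  have hpre := measurable_ArtinPsi hE
  have h := normMeasure_inter_preimage hinv hO (U := ball 0 1) subset_rfl (fun x hx _ => ?_) hE
  · have h1 : normMeasure μ (ball 0 1) = 1 := by
      have := normMeasure_ball hinv hO (x := 0) (m := 0) (by simp)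
      simpa using this
    rw [h1, one_mul] at h
    rw [Measure.map_apply measurable_ArtinPsi hE, ← h,
      normMeasure_apply (measurableSet_ball.inter hpre), normMeasure_apply hpre, inter_right_comm,
      inter_self, inter_comm]
  · rw [IsUltrametricDist.ball_eq_of_mem hx]
    rw [mem_ball, dist_eq_absInf, sub_zero] at hx
    exact ball_subset_ball (pow_le_one₀ (absInf_nonneg _) hx.le)

/-- Sets measurable with respect to the far future are independent of a given small ball. -/
lemma eventually_normMeasure_ball_inter (m : ℕ) (x : Khat k) :
    ∃ N : ℕ, ∀ n ≥ N, ∀ E : Set (Khat k), MeasurableSet E →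
      normMeasure μ (ball x ((Fintype.card k : ℝ)⁻¹ ^ m) ∩ (ArtinPsi (k := k))^[n] ⁻¹' E) =
        normMeasure μ (ball x ((Fintype.card k : ℝ)⁻¹ ^ m)) * normMeasure μ E := by
  have := isProbabilityMeasure_normMeasure hinv hO
  have hq := one_lt_card_real (k := k)
  have hmp := measurePreserving_ArtinPsi hinv hO
  induction m using Nat.strong_induction_on generalizing x with
  | _ m ih =>
  rcases ball_pow_subset_or_disjoint x m with hsub | hdis
  swap
  · have h0 : normMeasure μ (ball x ((Fintype.card k : ℝ)⁻¹ ^ m)) = 0 := by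
      rw [normMeasure_apply measurableSet_ball, hdis.inter_eq, measure_empty, mul_zero]
    exact ⟨0, fun n _ E _ => by rw [measure_mono_null inter_subset_left h0, h0, zero_mul]⟩
  by_cases hcyl : ∀ y ∈ ball x ((Fintype.card k : ℝ)⁻¹ ^ m), y ≠ 0 →
      ball y (absInf y ^ 2) ⊆ ball x ((Fintype.card k : ℝ)⁻¹ ^ m)
  · refine ⟨1, fun n hn E hE => ?_⟩
    obtain ⟨n, rfl⟩ := Nat.exists_eq_add_of_le' hn
    rw [Function.iterate_succ, preimage_comp,
      normMeasure_inter_preimage hinv hO hsub hcyl ((measurable_ArtinPsi.iterate n) hE),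
      (hmp.iterate n).measure_preimage hE.nullMeasurableSet]
  · push Not at hcyl
    obtain ⟨y, hy, hy0, hns⟩ := hcyl
    have hy1 : absInf y < 1 := by
      have := hsub hy
      rwa [mem_ball, dist_eq_absInf, sub_zero] at this
    rw [IsUltrametricDist.ball_eq_of_mem hy] at hns ⊢
    obtain ⟨j, hj, hyj⟩ := exists_absInf_eq_pow hy0 hy1
    have hpow : absInf y ^ 2 = (Fintype.card k : ℝ)⁻¹ ^ (j * 2) := by rw [hyj, pow_mul]
    have hjm : j * 2 < m := by
      by_contra hc
      refine hns (ball_subset_ball ?_)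
      rw [hpow]
      exact pow_le_pow_of_le_one (by positivity) (inv_le_one_of_one_le₀ hq.le) (not_lt.1 hc)
    have hself : y ∈ ball y (absInf y ^ 2) := mem_ball_self (pow_pos (absInf_pos hy0) 2)
    have hball := ArtinPsi_preimage_ball hy0 hy1 hself (inv_card_pow_le_one (k := k) (m - j * 2))
    rw [hpow, ← pow_add, Nat.sub_add_cancel hjm.le, ← hpow] at hball
    obtain ⟨N, hN⟩ := ih (m - j * 2) (by omega) (ArtinPsi y)
    refine ⟨N + 1, fun n hn E hE => ?_⟩
    obtain ⟨n, rfl⟩ := Nat.exists_eq_add_of_le' (Nat.le_trans (Nat.le_add_left 1 N) hn)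
    rw [← hball, normMeasure_cylinder hinv hO hy0 hy1 measurableSet_ball, mul_assoc,
      ← hN n (by omega) E hE, inter_assoc, Function.iterate_succ, preimage_comp, ← preimage_inter,
      normMeasure_cylinder hinv hO hy0 hy1
        (measurableSet_ball.inter ((measurable_ArtinPsi.iterate n) hE))]

/-- The Artin map is mixing. -/
lemma tendsto_normMeasure_inter {A B : Set (Khat k)} (hA : MeasurableSet A)
    (hB : MeasurableSet B) :
    Filter.Tendsto (fun n : ℕ => normMeasure μ (A ∩ (ArtinPsi (k := k))^[n] ⁻¹' B)) Filter.atTop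
      (nhds (normMeasure μ A * normMeasure μ B)) := by
  have := isProbabilityMeasure_normMeasure hinv hO
  have hmp := measurePreserving_ArtinPsi hinv hO
  have hBn (n : ℕ) : MeasurableSet ((ArtinPsi (k := k))^[n] ⁻¹' B) :=
    (measurable_ArtinPsi.iterate n) hB
  suffices h : Filter.Tendsto
      (fun n : ℕ => (normMeasure μ).real (A ∩ (ArtinPsi (k := k))^[n] ⁻¹' B)) Filter.atTop
      (nhds ((normMeasure μ).real A * (normMeasure μ).real B)) by
    have h2 := ENNReal.tendsto_ofReal h
    rw [ENNReal.ofReal_mul measureReal_nonneg] at h2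
    simpa only [ofReal_measureReal (measure_ne_top _ _)] using h2
  induction A, hA using MeasurableSpace.induction_on_inter borel_eq_generateFrom_smallBalls
    isPiSystem_smallBalls with
  | empty => simp
  | basic t ht =>
    obtain ⟨⟨x, m⟩, rfl⟩ := ht
    obtain ⟨N, hN⟩ := eventually_normMeasure_ball_inter hinv hO m x
    refine tendsto_const_nhds.congr' ?_
    filter_upwards [Filter.eventually_ge_atTop N] with n hn
    rw [measureReal_def, measureReal_def, measureReal_def, ← ENNReal.toReal_mul, hN n hn B hB]
  | compl t ht ih =>
    have h1 (n : ℕ) : (normMeasure μ).real (tᶜ ∩ (ArtinPsi (k := k))^[n] ⁻¹' B) =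
        (normMeasure μ).real B - (normMeasure μ).real (t ∩ (ArtinPsi (k := k))^[n] ⁻¹' B) := by
      have h2 := measureReal_inter_add_sdiff (μ := normMeasure μ)
        (s := (ArtinPsi (k := k))^[n] ⁻¹' B) ht
      rw [inter_comm, sdiff_eq, inter_comm _ tᶜ, measureReal_def _ ((ArtinPsi (k := k))^[n] ⁻¹' B),
        (hmp.iterate n).measure_preimage hB.nullMeasurableSet, ← measureReal_def] at h2
      linarith
    simp_rw [h1]
    rw [probReal_compl_eq_one_sub ht, sub_mul, one_mul]
    exact tendsto_const_nhds.sub ih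
  | iUnion f hd hf ih =>
    have hsum : HasSum (fun i => (normMeasure μ).real (f i)) ((normMeasure μ).real (⋃ i, f i)) :=
      hasSum_measureReal_iUnion _ hd hf
    have h1 (n : ℕ) : (normMeasure μ).real ((⋃ i, f i) ∩ (ArtinPsi (k := k))^[n] ⁻¹' B) =
        ∑' i, (normMeasure μ).real (f i ∩ (ArtinPsi (k := k))^[n] ⁻¹' B) := by
      rw [iUnion_inter]
      refine (hasSum_measureReal_iUnion _ (fun i j hij => ?_)
        fun i => (hf i).inter (hBn n)).tsum_eq.symm
      exact (hd hij).mono inter_subset_left inter_subset_left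
    simp_rw [h1]
    rw [← hsum.tsum_eq, ← tsum_mul_right]
    refine tendsto_tsum_of_dominated_convergence hsum.summable ih
      (Filter.Eventually.of_forall fun n i => ?_)
    rw [Real.norm_of_nonneg measureReal_nonneg]
    exact measureReal_mono inter_subset_left

lemma ergodic_ArtinPsi : Ergodic (ArtinPsi (k := k)) (normMeasure μ) := by
  have := isProbabilityMeasure_normMeasure hinv hO
  refine ⟨measurePreserving_ArtinPsi hinv hO, ⟨fun s hs hinvs => ?_⟩⟩
  have h (n : ℕ) : (ArtinPsi (k := k))^[n] ⁻¹' s = s := by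
    rw [preimage_iterate_eq]
    exact Function.iterate_fixed hinvs n
  have hlim := tendsto_normMeasure_inter hinv hO hs hs
  simp_rw [h, inter_self] at hlim
  have heq := tendsto_nhds_unique hlim tendsto_const_nhds
  rw [Filter.eventuallyConst_set']
  rcases eq_or_ne (normMeasure μ s) 0 with h0 | h0
  · exact Or.inl (ae_eq_empty.2 h0)
  · refine Or.inr ((ae_eq_univ_iff_measure_eq hs.nullMeasurableSet).2 ?_)
    rw [measure_univ]
    exact (ENNReal.mul_eq_left h0 (measure_ne_top _ _)).1 heq

end

end Mixing

/-- The Artin map `Ψ` is ergodic, and indeed mixing, with respect to the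
`Ψ`-invariant probability measure `q·μ|_(X⁻¹O ∩ ᶜK)`. -/
theorem statement_17 (k : Type*) [Field k] [Fintype k] (μ : MeasureTheory.Measure (Khat k))
    (hinv : ∀ x : Khat k, MeasureTheory.Measure.map (fun y => x + y) μ = μ)
    (hO : μ (Oball k) = 1) :
    Ergodic (ArtinPsi (k := k)) ((Fintype.card k : ℝ≥0∞) • μ.restrict (XinvO k ∩ cK k)) ∧
    (∀ A B : Set (Khat k), MeasurableSet A → MeasurableSet B →
      Filter.Tendsto
        (fun n : ℕ =>
          ((Fintype.card k : ℝ≥0∞) • μ.restrict (XinvO k ∩ cK k))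
            (A ∩ (ArtinPsi (k := k))^[n] ⁻¹' B))
        Filter.atTop
        (nhds (((Fintype.card k : ℝ≥0∞) • μ.restrict (XinvO k ∩ cK k)) A *
          ((Fintype.card k : ℝ≥0∞) • μ.restrict (XinvO k ∩ cK k)) B))) := by
  rw [normMeasure_eq hinv hO]
  exact ⟨ergodic_ArtinPsi hinv hO, fun A B hA hB => tendsto_normMeasure_inter hinv hO hA hB⟩

end ArtinCoding
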